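/- Let μ_N = (√(2N+1) + √(2N−1))/2 and define φ_τ(s) = (2N)^{1/4} τ_N φ_N(μ_N + τ_N s) and ψ_τ(s) = (2N)^{1/4} τ_N φ_{N−1}(μ_N + τ_N s). For every real s_L there exist constants C > 0 and N₀ ∈ ℕ such that for all N ≥ N₀ and all s ≥ s_L: (i) |φ_τ(s)| ≤ C e^{−s} and |ψ_τ(s)| ≤ C e^{−s}; (ii) |φ_τ(s) − Ai(s)| ≤ C N^{−1/3} e^{−s/2} and |ψ_τ(s) − Ai(s)| ≤ C N^{−1/3} e^{−s/2}; (iii) |φ_τ(s) + ψ_τ(s) − 2 Ai(s)| ≤ C N^{−2/3} e^{−s/2}. -/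

import Mathlib

open Real Filter MeasureTheory

/-- Physicists' Hermite polynomial `H_n(x) = (-1)^n e^{x²} (d^n/dx^n) e^{-x²}`. -/
noncomputable def physHermite (n : ℕ) (x : ℝ) : ℝ :=
  (-1 : ℝ) ^ n * Real.exp (x ^ 2) * iteratedDeriv n (fun t : ℝ => Real.exp (-t ^ 2)) x

/-- Normalizing constant `h_n = √π 2^n n!`. -/
noncomputable def hNorm (n : ℕ) : ℝ := Real.sqrt Real.pi * 2 ^ n * (n.factorial : ℝ)

/-- Oscillator wave function `φ_n(x) = h_n^{-1/2} e^{-x²/2} H_n(x)`. -/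
noncomputable def osc (n : ℕ) (x : ℝ) : ℝ :=
  hNorm n ^ (-(1 : ℝ) / 2) * Real.exp (-x ^ 2 / 2) * physHermite n x

/-- Airy function `Ai(x) = π⁻¹ lim_{R→∞} ∫₀^R cos(t³/3 + xt) dt`. -/
noncomputable def Ai (x : ℝ) : ℝ :=
  Real.pi⁻¹ *
    limUnder Filter.atTop (fun R : ℝ => ∫ t in (0 : ℝ)..R, Real.cos (t ^ 3 / 3 + x * t))

/-- Scaling constant `τ_N = 2^{-1/2} N^{-1/6}`. -/
noncomputable def tauN (N : ℕ) : ℝ := (2 : ℝ) ^ (-(1 : ℝ) / 2) * (N : ℝ) ^ (-(1 : ℝ) / 6)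

/-- `Δ_N = (√(2N+1) - √(2N-1))/τ_N`. -/
noncomputable def DeltaN (N : ℕ) : ℝ :=
  (Real.sqrt (2 * N + 1) - Real.sqrt (2 * N - 1)) / tauN N

/-- Unitary-case centering `μ_N = (√(2N+1) + √(2N-1))/2`. -/
noncomputable def muU (N : ℕ) : ℝ := (Real.sqrt (2 * N + 1) + Real.sqrt (2 * N - 1)) / 2

/-- `φ_τ(s) = (2N)^{1/4} τ_N φ_N(μ_N + τ_N s)`. -/
noncomputable def phiTau (N : ℕ) (s : ℝ) : ℝ :=
  (2 * N : ℝ) ^ ((1 : ℝ) / 4) * tauN N * osc N (muU N + tauN N * s)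

/-- `ψ_τ(s) = (2N)^{1/4} τ_N φ_{N-1}(μ_N + τ_N s)`. -/
noncomputable def psiTau (N : ℕ) (s : ℝ) : ℝ :=
  (2 * N : ℝ) ^ ((1 : ℝ) / 4) * tauN N * osc (N - 1) (muU N + tauN N * s)

open scoped Topology Interval

/-- Iterated derivatives of an entire function that is real on the real line. -/
theorem ofReal_iteratedDeriv_of_entire {f : ℝ → ℝ} {F : ℂ → ℂ} (hF : Differentiable ℂ F)
    (hfF : ∀ t : ℝ, (f t : ℂ) = F t) (n : ℕ) (x : ℝ) :
    ((iteratedDeriv n f x : ℝ) : ℂ) = iteratedDeriv n F x := by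
  induction n generalizing x with
  | zero => simpa using hfF x
  | succ n ih =>
    have hsm : ContDiff ℂ (n + 1 : ℕ) F := hF.contDiff
    have hd : Differentiable ℂ (iteratedDeriv n F) :=
      hsm.differentiable_iteratedDeriv n (by exact_mod_cast Nat.lt_succ_self n)
    have h1 : HasDerivAt (fun t : ℝ => iteratedDeriv n F (t : ℂ)) (iteratedDeriv (n + 1) F x) x := by
      rw [iteratedDeriv_succ]
      exact (hd (x : ℂ)).hasDerivAt.comp_ofReal
    have h2 : HasDerivAt (fun t : ℝ => ((iteratedDeriv n f t : ℝ) : ℂ)) (iteratedDeriv (n + 1) F x) x := by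
      simpa only [ih] using h1
    have h3 : HasDerivAt (iteratedDeriv n f) (iteratedDeriv (n + 1) F x).re x := by
      exact Complex.reCLM.hasFDerivAt.comp_hasDerivAt x h2
    rw [iteratedDeriv_succ, h3.deriv]
    have h4 := h3.ofReal_comp
    exact h4.unique h2

/-- Cauchy's integral for the Hermite polynomials, on the circle of radius `r` about `0`. -/
theorem physHermite_eq_integral (n : ℕ) (x : ℝ) {r : ℝ} (hr : 0 < r) :
    (physHermite n x : ℂ) = n.factorial * (2 * π)⁻¹ *
      ∫ θ in (-π)..π, Complex.exp (2 * x * (r * Complex.exp (θ * Complex.I)) -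
        (r * Complex.exp (θ * Complex.I)) ^ 2) * ((r * Complex.exp (θ * Complex.I)) ^ n)⁻¹ := by
  set F : ℂ → ℂ := fun z => Complex.exp (-z ^ 2) with hFdef
  have hF : Differentiable ℂ F := by fun_prop
  have hG : Differentiable ℂ (fun z : ℂ => F (x - z)) := by fun_prop
  have h1 : ((iteratedDeriv n (fun t : ℝ => Real.exp (-t ^ 2)) x : ℝ) : ℂ) = iteratedDeriv n F x :=
    ofReal_iteratedDeriv_of_entire hF (fun t => by simp [hFdef]) n x
  have h2 : iteratedDeriv n (fun z : ℂ => F (x - z)) 0 = (-1) ^ n * iteratedDeriv n F x := by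
    rw [iteratedDeriv_comp_const_sub]; simp
  have h3 := DiffContOnCl.circleIntegral_one_div_sub_center_pow_smul (c := 0) hr n
    (f := fun z : ℂ => F (x - z)) hG.diffContOnCl
  rw [h2, circleIntegral] at h3
  have h4 : (∫ θ in (0 : ℝ)..2 * π, deriv (circleMap 0 r) θ •
      (1 / (circleMap 0 r θ - 0) ^ (n + 1)) • F (x - circleMap 0 r θ)) =
      Complex.I * Complex.exp (-(x : ℂ) ^ 2) * ∫ θ in (-π)..π,
        Complex.exp (2 * x * (r * Complex.exp (θ * Complex.I)) -
        (r * Complex.exp (θ * Complex.I)) ^ 2) * ((r * Complex.exp (θ * Complex.I)) ^ n)⁻¹ := by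
    have hp : Function.Periodic (fun θ : ℝ => Complex.exp (2 * x * (r * Complex.exp (θ * Complex.I)) -
        (r * Complex.exp (θ * Complex.I)) ^ 2) * ((r * Complex.exp (θ * Complex.I)) ^ n)⁻¹)
        (2 * π) := by
      intro θ
      have : Complex.exp ((θ + 2 * π : ℝ) * Complex.I) = Complex.exp (θ * Complex.I) := by
        push_cast
        rw [add_mul, Complex.exp_add, Complex.exp_two_pi_mul_I, mul_one]
      simp only [this]
    have h5 := hp.intervalIntegral_add_eq (-π) 0
    rw [show -π + 2 * π = π by ring, zero_add] at h5
    rw [h5, ← intervalIntegral.integral_const_mul]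
    refine intervalIntegral.integral_congr fun θ _ => ?_
    simp only [deriv_circleMap, circleMap, zero_add, sub_zero, smul_eq_mul, hFdef]
    set z : ℂ := r * Complex.exp (θ * Complex.I) with hz
    have hz0 : z ≠ 0 := mul_ne_zero (by exact_mod_cast hr.ne') (Complex.exp_ne_zero _)
    rw [show -((x : ℂ) - z) ^ 2 = -(x : ℂ) ^ 2 + (2 * x * z - z ^ 2) by ring, Complex.exp_add,
      pow_succ]
    field_simp
  rw [h4] at h3
  have hfac : (n.factorial : ℂ) ≠ 0 := by exact_mod_cast n.factorial_ne_zero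
  have hpi : (π : ℂ) ≠ 0 := by exact_mod_cast Real.pi_ne_zero
  have hex : Complex.exp ((x : ℂ) ^ 2) * Complex.exp (-(x : ℂ) ^ 2) = 1 := by
    rw [← Complex.exp_add]; simp
  unfold physHermite
  push_cast
  rw [h1]
  simp only [smul_eq_mul] at h3
  set J := ∫ θ in (-π)..π, Complex.exp (2 * x * (r * Complex.exp (θ * Complex.I)) -
        (r * Complex.exp (θ * Complex.I)) ^ 2) * ((r * Complex.exp (θ * Complex.I)) ^ n)⁻¹
  have h6 : (-1 : ℂ) ^ n * iteratedDeriv n F x =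
      n.factorial * (2 * π : ℂ)⁻¹ * (Complex.exp (-(x : ℂ) ^ 2) * J) := by
    field_simp at h3 ⊢
    linear_combination -h3
  calc _ = Complex.exp ((x : ℂ) ^ 2) * ((-1 : ℂ) ^ n * iteratedDeriv n F x) := by ring
    _ = _ := by rw [h6]; linear_combination (n.factorial * (2 * π : ℂ)⁻¹ * J) * hex

/-- The exponent of the integrand of `φ_{N-k}` near its double saddle point, `h = N^{-1/3}`. -/
noncomputable def oscPhase (k h s : ℝ) (w : ℂ) : ℂ :=
  (2 * Complex.exp (h * w) - Complex.exp (2 * (h * w)) / 2 - h * w - 3 / 2) / h ^ 3 +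
    s * ((Complex.exp (h * w) - 1) / h) - h * s ^ 2 / 4 + k * (h * w)

/-- The exponent of the integrand of the Airy function. -/
noncomputable def airyPhase (s : ℝ) (w : ℂ) : ℂ := -w ^ 3 / 3 + s * w

/-- The first-order coefficient of `oscPhase k h s - airyPhase s` in powers of `h`. -/
noncomputable def phaseCorr (k s : ℝ) (w : ℂ) : ℂ := -(w ^ 2 - s) ^ 2 / 4 + k * w

/-- The vertical line `Re w = -1`. -/
noncomputable def vertLine (u : ℝ) : ℂ := -1 + u * Complex.I

/-- The contour integral representing `φ_{N-k}`, up to a normalizing constant. -/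
noncomputable def oscIntegral (k h s : ℝ) : ℂ :=
  (2 * π)⁻¹ * ∫ u in (-(π / h))..(π / h), Complex.exp (oscPhase k h s (vertLine u))

/-- The Airy function as an absolutely convergent contour integral. -/
noncomputable def airyIntegral (s : ℝ) : ℂ :=
  (2 * π)⁻¹ * ∫ u : ℝ, Complex.exp (airyPhase s (vertLine u))

theorem osc_eq_oscIntegral {n k : ℕ} {h c τ s : ℝ} (hh : 0 < h) (hc : 0 < c)
    (hc2 : c ^ 2 = 2 / h ^ 3) (hcτ : c * τ = 1 / h) (hτ2 : τ ^ 2 = h / 2)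
    (hn : (n : ℝ) + k = 1 / h ^ 3) :
    (osc n (c + τ * s) : ℂ) =
      ((hNorm n ^ (-(1 : ℝ) / 2) * n.factorial * ((c / 2) ^ n)⁻¹ * Real.exp (1 / h ^ 3 / 2) * h : ℝ) : ℂ)
        * oscIntegral k h s := by
  have hr : 0 < c / 2 * Real.exp (-h) := by positivity
  have hhC : (h : ℂ) ≠ 0 := by exact_mod_cast hh.ne'
  unfold osc
  push_cast
  rw [physHermite_eq_integral n (c + τ * s) hr, oscIntegral]
  have hsub := intervalIntegral.smul_integral_comp_mul_left (a := -(π / h)) (b := π / h)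
    (f := fun θ : ℝ => Complex.exp (2 * ((c + τ * s : ℝ) : ℂ) * (((c / 2 * Real.exp (-h) : ℝ) : ℂ) *
        Complex.exp (θ * Complex.I)) -
        (((c / 2 * Real.exp (-h) : ℝ) : ℂ) * Complex.exp (θ * Complex.I)) ^ 2) *
        ((((c / 2 * Real.exp (-h) : ℝ) : ℂ) * Complex.exp (θ * Complex.I)) ^ n)⁻¹) h
  rw [show h * -(π / h) = -π by field_simp, show h * (π / h) = π by field_simp] at hsub
  rw [← hsub]
  have key : ∀ u : ℝ, Complex.exp (-((c : ℂ) + τ * s) ^ 2 / 2) *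
      (Complex.exp (2 * ((c + τ * s : ℝ) : ℂ) * (((c / 2 * Real.exp (-h) : ℝ) : ℂ) *
        Complex.exp ((h * u : ℝ) * Complex.I)) -
        (((c / 2 * Real.exp (-h) : ℝ) : ℂ) * Complex.exp ((h * u : ℝ) * Complex.I)) ^ 2) *
        ((((c / 2 * Real.exp (-h) : ℝ) : ℂ) * Complex.exp ((h * u : ℝ) * Complex.I)) ^ n)⁻¹) =
      (((c / 2 : ℂ) ^ n)⁻¹ * Complex.exp (1 / h ^ 3 / 2)) *
        Complex.exp (oscPhase k h s (vertLine u)) := by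
    intro u
    have hz : ((c / 2 * Real.exp (-h) : ℝ) : ℂ) * Complex.exp ((h * u : ℝ) * Complex.I) =
        c / 2 * Complex.exp (h * vertLine u) := by
      rw [show (h : ℂ) * vertLine u = -h + (h * u : ℝ) * Complex.I by
        unfold vertLine; push_cast; ring, Complex.exp_add]
      push_cast; ring
    rw [hz, mul_pow _ _ n, ← Complex.exp_nat_mul, mul_inv, ← Complex.exp_neg]
    set w := vertLine u
    have e2 : Complex.exp (2 * (h * w)) = Complex.exp (h * w) ^ 2 := by
      rw [← Complex.exp_nat_mul]; norm_num
    have hc2' : (c : ℂ) ^ 2 = 2 / h ^ 3 := by exact_mod_cast hc2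
    have hcτ' : (c : ℂ) * τ = 1 / h := by exact_mod_cast hcτ
    have hτ2' : (τ : ℂ) ^ 2 = h / 2 := by exact_mod_cast hτ2
    have hn' : (n : ℂ) + k = 1 / h ^ 3 := by exact_mod_cast hn
    have hphase : -((c : ℂ) + τ * s) ^ 2 / 2 + (2 * ((c + τ * s : ℝ) : ℂ) *
        (c / 2 * Complex.exp (h * w)) - (c / 2 * Complex.exp (h * w)) ^ 2) + -(n * (h * w)) =
        1 / h ^ 3 / 2 + oscPhase k h s w := by
      unfold oscPhase
      rw [e2]
      push_cast
      set E := Complex.exp (h * w)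
      linear_combination (exp := 1) (-1 / 2 + E - E ^ 2 / 4) * hc2' + (-s + s * E) * hcτ' -
        s ^ 2 / 2 * hτ2' - (h * w) * hn'
    calc _ = ((c / 2 : ℂ) ^ n)⁻¹ * (Complex.exp (-((c : ℂ) + τ * s) ^ 2 / 2) *
          Complex.exp (2 * ((c + τ * s : ℝ) : ℂ) *
        (c / 2 * Complex.exp (h * w)) - (c / 2 * Complex.exp (h * w)) ^ 2) *
        Complex.exp (-(n * (h * w)))) := by ring
      _ = _ := by rw [← Complex.exp_add, ← Complex.exp_add, hphase, Complex.exp_add, mul_assoc]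
  calc _ = ((hNorm n ^ (-(1 : ℝ) / 2) : ℝ) : ℂ) * n.factorial * (2 * π)⁻¹ * h *
        (Complex.exp (-((c : ℂ) + τ * s) ^ 2 / 2) * ∫ u in (-(π / h))..(π / h),
        (Complex.exp (2 * ((c + τ * s : ℝ) : ℂ) * (((c / 2 * Real.exp (-h) : ℝ) : ℂ) *
        Complex.exp ((h * u : ℝ) * Complex.I)) -
        (((c / 2 * Real.exp (-h) : ℝ) : ℂ) * Complex.exp ((h * u : ℝ) * Complex.I)) ^ 2) *
        ((((c / 2 * Real.exp (-h) : ℝ) : ℂ) * Complex.exp ((h * u : ℝ) * Complex.I)) ^ n)⁻¹)) := by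
        simp only [Complex.real_smul]; ring
    _ = _ := by
      rw [← intervalIntegral.integral_const_mul]
      simp only [key]
      rw [intervalIntegral.integral_const_mul]
      ring

theorem norm_exp_airyPhase (s σ t : ℝ) :
    ‖Complex.exp (airyPhase s (σ + t * Complex.I))‖ =
      Real.exp (-σ ^ 3 / 3 + σ * t ^ 2 + s * σ) := by
  rw [Complex.norm_exp]
  congr 1
  have : airyPhase s (σ + t * Complex.I) =
      ((-σ ^ 3 / 3 + σ * t ^ 2 + s * σ : ℝ) : ℂ) +
        ((-σ ^ 2 * t + t ^ 3 / 3 + s * t : ℝ) : ℂ) * Complex.I := by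
    unfold airyPhase
    push_cast
    have hI := Complex.I_sq
    linear_combination (-(σ * t ^ 2 : ℂ) - t ^ 3 / 3 * Complex.I) * hI
  rw [this, Complex.add_re, Complex.ofReal_re, Complex.re_ofReal_mul, Complex.I_re, mul_zero,
    add_zero]

theorem norm_exp_airyPhase_vertLine (s u : ℝ) :
    ‖Complex.exp (airyPhase s (vertLine u))‖ = Real.exp (1 / 3 - s) * Real.exp (-u ^ 2) := by
  have := norm_exp_airyPhase s (-1) u
  rw [vertLine]
  push_cast at this
  rw [this, ← Real.exp_add]
  congr 1
  ring

theorem continuous_vertLine : Continuous vertLine := by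
  unfold vertLine
  fun_prop

theorem continuous_airyPhase (s : ℝ) : Continuous (airyPhase s) := by
  unfold airyPhase
  fun_prop

theorem integrable_exp_airyPhase (s : ℝ) :
    Integrable fun u : ℝ => Complex.exp (airyPhase s (vertLine u)) := by
  have hg : Integrable fun u : ℝ => Real.exp (1 / 3 - s) * Real.exp (-u ^ 2) := by
    simpa using (integrable_exp_neg_mul_sq one_pos).const_mul (Real.exp (1 / 3 - s))
  refine hg.mono' ?_ (Eventually.of_forall fun u => (norm_exp_airyPhase_vertLine s u).le)
  exact (((continuous_airyPhase s).comp continuous_vertLine).cexp).aestronglyMeasurable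

theorem tendsto_integral_horizontal_edge (s : ℝ) {ε : ℝ} (hε : ε ^ 2 = 1) :
    Tendsto (fun R : ℝ => ∫ x in (-1 : ℝ)..0,
      Complex.exp (airyPhase s (x + (ε * R : ℝ) * Complex.I))) atTop (𝓝 0) := by
  have h0 : (∫ _ in (-1 : ℝ)..0, (0 : ℂ)) = 0 := by simp
  rw [← h0]
  refine intervalIntegral.tendsto_integral_filter_of_dominated_convergence
    (fun _ => Real.exp (1 / 3 + |s|)) ?_ ?_ ?_ ?_
  · refine Eventually.of_forall fun R => Continuous.aestronglyMeasurable ?_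
    have := continuous_airyPhase s
    fun_prop
  · refine Eventually.of_forall fun R => Eventually.of_forall fun x hx => ?_
    rw [Set.uIoc_of_le (by norm_num)] at hx
    rw [norm_exp_airyPhase]
    apply Real.exp_le_exp.mpr
    have h1 : -1 ≤ x := hx.1.le
    have h2 : x ≤ 0 := hx.2
    have h3 : x * (ε * R) ^ 2 ≤ 0 := mul_nonpos_of_nonpos_of_nonneg h2 (sq_nonneg _)
    have h4 : s * x ≤ |s| := by
      calc s * x ≤ |s * x| := le_abs_self _
        _ = |s| * |x| := abs_mul _ _
        _ ≤ |s| * 1 := by gcongr; exact abs_le.mpr ⟨h1, by linarith⟩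
        _ = |s| := mul_one _
    have h5 : -x ^ 3 ≤ 1 := by nlinarith [mul_nonneg (sq_nonneg x) (by linarith : (0:ℝ) ≤ 1 + x), sq_nonneg x]
    linarith
  · simp
  · have hne : ∀ᵐ x : ℝ, x ≠ 0 := by simp [ae_iff]
    filter_upwards [hne] with x hx0 hx
    rw [Set.uIoc_of_le (by norm_num)] at hx
    have hxneg : x < 0 := lt_of_le_of_ne hx.2 hx0
    rw [tendsto_zero_iff_norm_tendsto_zero]
    simp only [norm_exp_airyPhase, mul_pow, hε, one_mul]
    refine Real.tendsto_exp_atBot.comp ?_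
    have : Tendsto (fun R : ℝ => x * R ^ 2) atTop atBot :=
      (tendsto_pow_atTop two_ne_zero).const_mul_atTop_of_neg hxneg
    exact (tendsto_atBot_add_const_right _ (s * x)
      (tendsto_atBot_add_const_left _ (-x ^ 3 / 3) this))

theorem integral_exp_airyPhase_imag (s R : ℝ) :
    ∫ t in (-R)..R, Complex.exp (airyPhase s (t * Complex.I)) =
      2 * ((∫ t in (0 : ℝ)..R, Real.cos (t ^ 3 / 3 + s * t) : ℝ) : ℂ) := by
  have hf : ∀ t : ℝ, Complex.exp (airyPhase s (t * Complex.I)) =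
      (Real.cos (t ^ 3 / 3 + s * t) : ℂ) + (Real.sin (t ^ 3 / 3 + s * t) : ℂ) * Complex.I := by
    intro t
    rw [Complex.ofReal_cos, Complex.ofReal_sin, ← Complex.exp_mul_I]
    congr 1
    unfold airyPhase
    push_cast
    linear_combination (-(t : ℂ) ^ 3 / 3 * Complex.I) * Complex.I_sq
  have hc : Continuous fun t : ℝ => Complex.exp (airyPhase s (t * Complex.I)) := by
    have := continuous_airyPhase s
    fun_prop
  rw [← intervalIntegral.integral_add_adjacent_intervals (hc.intervalIntegrable _ 0)
    (hc.intervalIntegrable _ _)]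
  have hneg := intervalIntegral.integral_comp_neg (a := 0) (b := R)
    (fun t : ℝ => Complex.exp (airyPhase s (t * Complex.I)))
  rw [neg_zero] at hneg
  have hc' : Continuous fun t : ℝ => Complex.exp (airyPhase s ((-t : ℝ) * Complex.I)) :=
    hc.comp continuous_neg
  rw [← hneg, ← intervalIntegral.integral_add (hc'.intervalIntegrable _ _)
    (hc.intervalIntegrable _ _), ← intervalIntegral.integral_ofReal,
    ← intervalIntegral.integral_const_mul]
  refine intervalIntegral.integral_congr fun t _ => ?_
  rw [hf, hf, show (-t) ^ 3 / 3 + s * -t = -(t ^ 3 / 3 + s * t) by ring, Real.cos_neg, Real.sin_neg]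
  push_cast
  ring

/-- The Airy function as an absolutely convergent integral over the line `Re w = -1`. -/
theorem ofReal_Ai (s : ℝ) : (Ai s : ℂ) = airyIntegral s := by
  have hdiff : Differentiable ℂ fun w => Complex.exp (airyPhase s w) := by
    unfold airyPhase
    fun_prop
  have hrect : ∀ R : ℝ, 2 * ((∫ t in (0 : ℝ)..R, Real.cos (t ^ 3 / 3 + s * t) : ℝ) : ℂ) =
      (∫ t in (-R)..R, Complex.exp (airyPhase s (vertLine t))) +
      Complex.I * ((∫ x in (-1 : ℝ)..0, Complex.exp (airyPhase s (x + (-1 * R : ℝ) * Complex.I))) -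
      ∫ x in (-1 : ℝ)..0, Complex.exp (airyPhase s (x + (1 * R : ℝ) * Complex.I))) := by
    intro R
    have h := Complex.integral_boundary_rect_eq_zero_of_differentiableOn
      (fun w => Complex.exp (airyPhase s w)) (⟨-1, -R⟩ : ℂ) (⟨0, R⟩ : ℂ) hdiff.differentiableOn
    rw [← integral_exp_airyPhase_imag]
    simp only [Complex.ofReal_zero, zero_add, smul_eq_mul] at h
    unfold vertLine
    push_cast at h ⊢
    simp only [one_mul, neg_mul] at h ⊢
    linear_combination (-Complex.I) * h + ((∫ t in (-R)..R, Complex.exp (airyPhase s (t * Complex.I)))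
      - (∫ t in (-R)..R, Complex.exp (airyPhase s (-1 + t * Complex.I)))) * Complex.I_sq
  have hlim : Tendsto (fun R : ℝ => ((∫ t in (0 : ℝ)..R, Real.cos (t ^ 3 / 3 + s * t) : ℝ) : ℂ))
      atTop (𝓝 (π * airyIntegral s)) := by
    have h1 := intervalIntegral_tendsto_integral (integrable_exp_airyPhase s)
      tendsto_neg_atTop_atBot tendsto_id
    have h2 := (h1.add (((tendsto_integral_horizontal_edge s (ε := -1) (by norm_num)).sub
      (tendsto_integral_horizontal_edge s (ε := 1) (by norm_num))).const_mul Complex.I)).const_mul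
      (1 / 2 : ℂ)
    have hpi : (π : ℂ) ≠ 0 := by exact_mod_cast Real.pi_ne_zero
    have e1 : (1 / 2 : ℂ) * ((∫ u : ℝ, Complex.exp (airyPhase s (vertLine u))) +
        Complex.I * (0 - 0)) = π * airyIntegral s := by
      unfold airyIntegral
      push_cast
      field_simp
      ring
    rw [e1] at h2
    refine h2.congr fun R => ?_
    simp only [id]
    rw [← hrect]
    ring
  have hre := (Complex.continuous_re.tendsto _).comp hlim
  have him := (Complex.continuous_im.tendsto _).comp hlim
  have him0 : (π * airyIntegral s).im = 0 := by
    refine tendsto_nhds_unique him ?_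
    simp only [Function.comp_def, Complex.ofReal_im]
    exact tendsto_const_nhds
  simp only [Function.comp_def, Complex.ofReal_re] at hre
  have hlu := hre.limUnder_eq
  rw [Complex.re_ofReal_mul] at hlu
  rw [Complex.im_ofReal_mul] at him0
  unfold Ai
  rw [hlu]
  apply Complex.ext
  · simp
  · simpa [Real.pi_ne_zero, eq_comm] using him0

theorem norm_exp_sub_one_le_mul_max (d : ℂ) :
    ‖Complex.exp d - 1‖ ≤ 2 * ‖d‖ * max 1 (Real.exp d.re) := by
  have hm1 : (1 : ℝ) ≤ max 1 (Real.exp d.re) := le_max_left _ _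
  have hm2 : ‖Complex.exp d‖ ≤ max 1 (Real.exp d.re) := by
    rw [Complex.norm_exp]; exact le_max_right _ _
  have hd0 := norm_nonneg d
  rcases le_or_gt ‖d‖ 1 with hd | hd
  · calc _ ≤ 2 * ‖d‖ := Complex.norm_exp_sub_one_le hd
      _ ≤ _ := le_mul_of_one_le_right (by positivity) hm1
  · calc _ ≤ ‖Complex.exp d‖ + 1 := by simpa using norm_sub_le (Complex.exp d) 1
      _ ≤ 2 * 1 * max 1 (Real.exp d.re) := by linarith
      _ ≤ _ := by gcongr

theorem norm_exp_sub_one_sub_id_le_mul_max (d : ℂ) :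
    ‖Complex.exp d - 1 - d‖ ≤ 3 * ‖d‖ ^ 2 * max 1 (Real.exp d.re) := by
  have hm1 : (1 : ℝ) ≤ max 1 (Real.exp d.re) := le_max_left _ _
  have hd0 := norm_nonneg d
  rcases le_or_gt ‖d‖ 1 with hd | hd
  · calc _ ≤ ‖d‖ ^ 2 := Complex.norm_exp_sub_one_sub_id_le hd
      _ ≤ 3 * ‖d‖ ^ 2 * 1 := by nlinarith [sq_nonneg ‖d‖]
      _ ≤ _ := by gcongr
  · have h1 := norm_exp_sub_one_le_mul_max d
    have h2 : ‖d‖ ≤ ‖d‖ ^ 2 := by nlinarith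
    calc _ ≤ ‖Complex.exp d - 1‖ + ‖d‖ := norm_sub_le _ _
      _ ≤ 2 * ‖d‖ * max 1 (Real.exp d.re) + ‖d‖ * max 1 (Real.exp d.re) :=
        add_le_add h1 (le_mul_of_one_le_right hd0 hm1)
      _ = 3 * ‖d‖ * max 1 (Real.exp d.re) := by ring
      _ ≤ _ := by gcongr

theorem norm_oscPhase_sub_le {k h s : ℝ} {w : ℂ} (h0 : 0 < h) (hw : ‖h * w‖ ≤ 5) :
    ‖oscPhase k h s w - airyPhase s w - h * phaseCorr k s w‖ ≤
      h ^ 2 * (Real.exp 10 * (18 * ‖w‖ ^ 5 + |s| * ‖w‖ ^ 3)) := by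
  have hhC : (h : ℂ) ≠ 0 := by exact_mod_cast h0.ne'
  have hnh : ‖(h : ℂ)‖ = h := by simp [abs_of_pos h0]
  have t1 := Complex.norm_exp_sub_sum_le_norm_mul_exp (h * w) 5
  have t2 := Complex.norm_exp_sub_sum_le_norm_mul_exp (2 * (h * w)) 5
  have t3 := Complex.norm_exp_sub_sum_le_norm_mul_exp (h * w) 3
  have e1 : Real.exp ‖h * w‖ ≤ Real.exp 10 := Real.exp_le_exp.mpr (by linarith)
  have e2 : Real.exp ‖2 * (h * w)‖ ≤ Real.exp 10 := by
    apply Real.exp_le_exp.mpr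
    rw [norm_mul, Complex.norm_ofNat]
    linarith
  set r1 := Complex.exp (h * w) - ∑ m ∈ Finset.range 5, (h * w) ^ m / m.factorial with hr1
  set r2 := Complex.exp (2 * (h * w)) - ∑ m ∈ Finset.range 5, (2 * (h * w)) ^ m / m.factorial with hr2
  set r3 := Complex.exp (h * w) - ∑ m ∈ Finset.range 3, (h * w) ^ m / m.factorial with hr3
  have hid : oscPhase k h s w - airyPhase s w - h * phaseCorr k s w =
      (2 * r1 - r2 / 2) / h ^ 3 + s * r3 / h := by
    rw [hr1, hr2, hr3]
    simp only [Finset.sum_range_succ, Finset.sum_range_zero, Nat.factorial]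
    unfold oscPhase airyPhase phaseCorr
    push_cast
    field_simp
    ring
  have b1 : ‖r1‖ ≤ h ^ 5 * (‖w‖ ^ 5 * Real.exp 10) := by
    calc _ ≤ ‖h * w‖ ^ 5 * Real.exp 10 := t1.trans (by gcongr)
      _ = _ := by rw [norm_mul, hnh]; ring
  have b2 : ‖r2‖ ≤ h ^ 5 * (32 * ‖w‖ ^ 5 * Real.exp 10) := by
    calc _ ≤ ‖2 * (h * w)‖ ^ 5 * Real.exp 10 := t2.trans (by gcongr)
      _ = _ := by rw [norm_mul, norm_mul, hnh]; norm_num; ring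
  have b3 : ‖r3‖ ≤ h ^ 3 * (‖w‖ ^ 3 * Real.exp 10) := by
    calc _ ≤ ‖h * w‖ ^ 3 * Real.exp 10 := t3.trans (by gcongr)
      _ = _ := by rw [norm_mul, hnh]; ring
  rw [hid]
  calc _ ≤ ‖(2 * r1 - r2 / 2) / h ^ 3‖ + ‖s * r3 / h‖ := norm_add_le _ _
    _ = ‖2 * r1 - r2 / 2‖ / h ^ 3 + |s| * ‖r3‖ / h := by
      simp only [norm_div, norm_pow, norm_mul, hnh, Complex.norm_real, Real.norm_eq_abs]
    _ ≤ (2 * ‖r1‖ + ‖r2‖ / 2) / h ^ 3 + |s| * ‖r3‖ / h := by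
      gcongr
      calc _ ≤ ‖2 * r1‖ + ‖r2 / 2‖ := norm_sub_le _ _
        _ = _ := by simp
    _ ≤ (2 * (h ^ 5 * (‖w‖ ^ 5 * Real.exp 10)) + (h ^ 5 * (32 * ‖w‖ ^ 5 * Real.exp 10)) / 2) / h ^ 3 +
        |s| * (h ^ 3 * (‖w‖ ^ 3 * Real.exp 10)) / h := by gcongr
    _ = _ := by field_simp; ring

theorem exp_neg_le_quadratic {h : ℝ} (h0 : 0 ≤ h) : Real.exp (-h) ≤ 1 - h + h ^ 2 / 2 := by
  have h1 := Real.quadratic_le_exp_of_nonneg h0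
  rw [Real.exp_neg, inv_le_iff_one_le_mul₀ (Real.exp_pos h)]
  calc (1 : ℝ) ≤ (1 - h + h ^ 2 / 2) * (1 + h + h ^ 2 / 2) := by nlinarith [pow_nonneg h0 4]
    _ ≤ _ := by
      gcongr
      nlinarith [sq_nonneg (h - 1)]

theorem oscPhase_vertLine_re (k h s u : ℝ) :
    (oscPhase k h s (vertLine u)).re =
      (2 * (Real.exp (-h) * Real.cos (h * u)) -
        Real.exp (-h) ^ 2 * (2 * Real.cos (h * u) ^ 2 - 1) / 2 + h - 3 / 2) / h ^ 3 +
      s * ((Real.exp (-h) * Real.cos (h * u) - 1) / h) - h * s ^ 2 / 4 - k * h := by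
  have e1 : (h : ℂ) * vertLine u = ((-h : ℝ) : ℂ) + ((h * u : ℝ) : ℂ) * Complex.I := by
    unfold vertLine; push_cast; ring
  have e2 : 2 * ((h : ℂ) * vertLine u) =
      ((-h + -h : ℝ) : ℂ) + ((2 * (h * u) : ℝ) : ℂ) * Complex.I := by
    unfold vertLine; push_cast; ring
  have r1 : (Complex.exp (h * vertLine u)).re = Real.exp (-h) * Real.cos (h * u) := by
    rw [Complex.exp_re, e1]; simp
  have r2 : (Complex.exp (2 * (h * vertLine u))).re =
      Real.exp (-h) ^ 2 * (2 * Real.cos (h * u) ^ 2 - 1) := by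
    rw [Complex.exp_re, e2, ← Real.cos_two_mul, sq, ← Real.exp_add]
    simp only [Complex.add_re, Complex.ofReal_re, Complex.re_ofReal_mul, Complex.I_re, mul_zero,
      add_zero, Complex.add_im, Complex.ofReal_im, Complex.im_ofReal_mul, Complex.I_im, mul_one,
      zero_add]
  have r3 : ((h : ℂ) * vertLine u).re = -h := by rw [e1]; simp
  have e3 : oscPhase k h s (vertLine u) =
      ((1 / h ^ 3 : ℝ) : ℂ) * (((2 : ℝ) : ℂ) * Complex.exp (h * vertLine u) -
        ((1 / 2 : ℝ) : ℂ) * Complex.exp (2 * (h * vertLine u)) -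
        h * vertLine u - ((3 / 2 : ℝ) : ℂ)) + ((s / h : ℝ) : ℂ) *
        (Complex.exp (h * vertLine u) - ((1 : ℝ) : ℂ)) - ((h * s ^ 2 / 4 : ℝ) : ℂ) +
        (k : ℂ) * (h * vertLine u) := by
    unfold oscPhase; push_cast; ring
  rw [e3]
  simp only [Complex.add_re, Complex.sub_re, Complex.re_ofReal_mul (1 / h ^ 3),
    Complex.re_ofReal_mul (s / h), Complex.re_ofReal_mul 2, Complex.re_ofReal_mul (1 / 2),
    Complex.re_ofReal_mul k, r1, r2, r3, Complex.ofReal_re]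
  ring

theorem norm_exp_oscPhase_le {k h s L u : ℝ} (hk : 0 ≤ k) (h0 : 0 < h) (h1 : h ≤ 1 / 2)
    (hhL : h * (1 + L) ≤ 1) (hs : -L ≤ s) (hu : |h * u| ≤ π) :
    ‖Complex.exp (oscPhase k h s (vertLine u))‖ ≤
      Real.exp (1 - s) * Real.exp (-(1 / 10) * u ^ 2) := by
  rw [Complex.norm_exp, ← Real.exp_add, oscPhase_vertLine_re]
  apply Real.exp_le_exp.mpr
  have hcos := Real.cos_le_one_sub_mul_cos_sq hu
  have hc1 := Real.cos_le_one (h * u)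
  have hρ1 := Real.add_one_le_exp (-h)
  have hρ2 := exp_neg_le_quadratic h0.le
  set c := Real.cos (h * u)
  set ρ := Real.exp (-h)
  have hpi : π ^ 2 < 10 := by nlinarith [Real.pi_lt_d2, Real.pi_pos]
  have hρhalf : 1 / 2 ≤ ρ := by linarith
  have hρle : ρ ≤ 1 := by nlinarith
  -- the value at `u = 0`
  have ha : (2 * ρ - ρ ^ 2 / 2 + h - 3 / 2) / h ^ 3 ≤ 1 / 2 := by
    rw [div_le_iff₀ (by positivity)]
    nlinarith [mul_nonneg (sub_nonneg.mpr hρ2) (by nlinarith : 0 ≤ 4 - ρ - (1 - h + h ^ 2 / 2)),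
      pow_pos h0 4]
  -- the Gaussian decay in `u`
  have hb1 : 2 / 10 * (h * u) ^ 2 ≤ 1 - c := by
    have : 2 / 10 * (h * u) ^ 2 ≤ 2 / π ^ 2 * (h * u) ^ 2 := by gcongr
    linarith
  have hb : -((1 - c) * ρ * (2 - ρ * (1 + c))) / h ^ 3 - s * (ρ * (1 - c) / h) ≤
      -(1 / 10) * u ^ 2 := by
    have hcpos : 0 ≤ (1 - c) * ρ := mul_nonneg (by linarith) (by linarith)
    have e1 : h ≤ 2 - ρ * (1 + c) - L * h ^ 2 := by nlinarith
    have e2 : (1 - c) * ρ * h ≤ (1 - c) * ρ * (2 - ρ * (1 + c) - L * h ^ 2) := by gcongr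
    have e3 : h ^ 2 * u ^ 2 / 10 ≤ (1 - c) * ρ := by nlinarith
    have e4 : -s * ((1 - c) * ρ * h ^ 2) ≤ L * ((1 - c) * ρ * h ^ 2) := by
      gcongr; linarith
    have e5 : h ^ 2 * u ^ 2 / 10 * h ≤ (1 - c) * ρ * h := by gcongr
    have e6 : -((1 - c) * ρ * (2 - ρ * (1 + c))) / h ^ 3 - s * (ρ * (1 - c) / h) =
        (-((1 - c) * ρ * (2 - ρ * (1 + c))) + -s * ((1 - c) * ρ * h ^ 2)) / h ^ 3 := by
      field_simp
      ring
    rw [e6, div_le_iff₀ (by positivity)]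
    nlinarith
  have hc : s * ((ρ - 1) / h) - h * s ^ 2 / 4 ≤ 1 / 2 - s := by
    have g1 : (ρ - 1) / h ≤ -1 + h / 2 := by
      rw [div_le_iff₀ h0]; nlinarith
    have g2 : -1 ≤ (ρ - 1) / h := by
      rw [le_div_iff₀ h0]; linarith
    rcases le_total 0 s with hs0 | hs0
    · nlinarith [mul_le_mul_of_nonneg_left g1 hs0, mul_nonneg h0.le (sq_nonneg (s - 1))]
    · nlinarith [mul_le_mul_of_nonpos_left g2 hs0, mul_nonneg h0.le (sq_nonneg s)]
  have hkh : 0 ≤ k * h := mul_nonneg hk h0.le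
  have hsum : (2 * (ρ * c) - ρ ^ 2 * (2 * c ^ 2 - 1) / 2 + h - 3 / 2) / h ^ 3 +
      s * ((ρ * c - 1) / h) - h * s ^ 2 / 4 - k * h =
      (2 * ρ - ρ ^ 2 / 2 + h - 3 / 2) / h ^ 3 +
      (-((1 - c) * ρ * (2 - ρ * (1 + c))) / h ^ 3 - s * (ρ * (1 - c) / h)) +
      (s * ((ρ - 1) / h) - h * s ^ 2 / 4) - k * h := by
    field_simp
    ring
  rw [hsum]
  linarith

theorem norm_vertLine_le (u : ℝ) : ‖vertLine u‖ ≤ 1 + |u| := by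
  unfold vertLine
  calc _ ≤ ‖(-1 : ℂ)‖ + ‖u * Complex.I‖ := norm_add_le _ _
    _ = _ := by simp

theorem norm_phaseCorr_le {k s u X : ℝ} (hk0 : 0 ≤ k) (hk1 : k ≤ 1) (hX : 1 ≤ X)
    (hs : |s| ≤ X) (hu : 1 + |u| ≤ X) : ‖phaseCorr k s (vertLine u)‖ ≤ 2 * X ^ 5 := by
  have hw : ‖vertLine u‖ ≤ X := (norm_vertLine_le u).trans hu
  have h5 : X ≤ X ^ 5 := le_self_pow₀ hX (by norm_num)
  have h2 : X ≤ X ^ 2 := le_self_pow₀ hX (by norm_num)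
  have h45 : X ^ 4 ≤ X ^ 5 := pow_le_pow_right₀ hX (by norm_num)
  unfold phaseCorr
  calc _ ≤ ‖-(vertLine u ^ 2 - s) ^ 2 / 4‖ + ‖k * vertLine u‖ := norm_add_le _ _
    _ = ‖vertLine u ^ 2 - s‖ ^ 2 / 4 + k * ‖vertLine u‖ := by
      simp [abs_of_nonneg hk0]
    _ ≤ (‖vertLine u‖ ^ 2 + |s|) ^ 2 / 4 + 1 * ‖vertLine u‖ := by
      gcongr
      calc _ ≤ ‖vertLine u ^ 2‖ + ‖(s : ℂ)‖ := norm_sub_le _ _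
        _ = _ := by simp
    _ ≤ (X ^ 2 + X ^ 2) ^ 2 / 4 + 1 * X := by gcongr; linarith
    _ ≤ _ := by nlinarith

theorem norm_exp_airyPhase_vertLine_le (s u : ℝ) :
    ‖Complex.exp (airyPhase s (vertLine u))‖ ≤
      Real.exp (1 - s) * Real.exp (-(1 / 10) * u ^ 2) := by
  rw [norm_exp_airyPhase_vertLine]
  gcongr
  · norm_num
  · nlinarith [sq_nonneg u]

theorem norm_exp_oscPhase_sub_le {B k h s L u X : ℝ} (hB : 2 + 19 * Real.exp 10 ≤ B) (hk0 : 0 ≤ k)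
    (hk1 : k ≤ 1) (h0 : 0 < h) (hh : h ≤ 1 / 2) (hhL : h * (1 + L) ≤ 1) (hs : -L ≤ s)
    (hX : 1 ≤ X) (hsX : |s| ≤ X) (huX : 1 + |u| ≤ X) (hhu : |h * u| ≤ π) :
    ‖Complex.exp (oscPhase k h s (vertLine u)) - Complex.exp (airyPhase s (vertLine u)) -
      h * (phaseCorr k s (vertLine u) * Complex.exp (airyPhase s (vertLine u)))‖ ≤
    (3 * B ^ 2 + B) * (h ^ 2 * X ^ 10 *
      (Real.exp (1 - s) * Real.exp (-(1 / 10) * u ^ 2))) := by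
  have hnh : ‖(h : ℂ)‖ = h := by simp [abs_of_pos h0]
  have hX5 : X ^ 5 ≤ X ^ 10 := pow_le_pow_right₀ hX (by norm_num)
  have hE : 0 < Real.exp 10 := Real.exp_pos _
  have hQ := norm_phaseCorr_le hk0 hk1 hX hsX huX
  have hP := norm_exp_airyPhase_vertLine_le s u
  have hK := norm_exp_oscPhase_le hk0 h0 hh hhL hs hhu
  have hM : 0 < Real.exp (1 - s) * Real.exp (-(1 / 10) * u ^ 2) := by positivity
  have hw5 : ‖h * vertLine u‖ ≤ 5 := by
    rw [norm_mul, hnh]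
    rw [abs_mul, abs_of_pos h0] at hhu
    have := mul_le_mul_of_nonneg_left (norm_vertLine_le u) h0.le
    linarith [Real.pi_lt_four]
  have hR := norm_oscPhase_sub_le (k := k) (s := s) h0 hw5
  have hw : ‖vertLine u‖ ≤ X := (norm_vertLine_le u).trans huX
  generalize Real.exp (1 - s) * Real.exp (-(1 / 10) * u ^ 2) = M at hP hK hM ⊢
  generalize phaseCorr k s (vertLine u) = Q at hQ hR ⊢
  generalize airyPhase s (vertLine u) = P at hP hR ⊢
  generalize oscPhase k h s (vertLine u) = K at hK hR ⊢
  generalize Real.exp 10 = E at hB hR hE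
  set D := K - P with hD
  have hR' : ‖D - h * Q‖ ≤ h ^ 2 * (19 * E * X ^ 5) := by
    refine hR.trans ?_
    have : |s| * ‖vertLine u‖ ^ 3 ≤ X ^ 5 := by
      calc _ ≤ X * X ^ 3 := by gcongr
        _ = X ^ 4 := by ring
        _ ≤ X ^ 5 := pow_le_pow_right₀ hX (by norm_num)
    have h18 : ‖vertLine u‖ ^ 5 ≤ X ^ 5 := by gcongr
    calc _ ≤ h ^ 2 * (E * (18 * X ^ 5 + X ^ 5)) := by gcongr
      _ = _ := by ring
  have hDn : ‖D‖ ≤ h * (B * X ^ 5) := by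
    calc ‖D‖ = ‖(D - h * Q) + h * Q‖ := by rw [sub_add_cancel]
      _ ≤ ‖D - h * Q‖ + ‖h * Q‖ := norm_add_le _ _
      _ ≤ h ^ 2 * (19 * E * X ^ 5) + h * (2 * X ^ 5) := by
        rw [norm_mul, hnh]; gcongr
      _ ≤ h * (19 * E * X ^ 5) + h * (2 * X ^ 5) := by gcongr; nlinarith
      _ = h * ((2 + 19 * E) * X ^ 5) := by ring
      _ ≤ _ := by gcongr
  have hKP : Complex.exp K = Complex.exp P * Complex.exp D := by
    rw [← Complex.exp_add, hD, add_sub_cancel]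
  have hmax : ‖Complex.exp P‖ * max 1 (Real.exp D.re) ≤ M := by
    rw [mul_max_of_nonneg _ _ (norm_nonneg _), mul_one]
    refine max_le hP ?_
    rw [← Complex.norm_exp D, ← norm_mul, ← hKP]
    exact hK
  have hid : Complex.exp K - Complex.exp P - h * (Q * Complex.exp P) =
      Complex.exp P * (Complex.exp D - 1 - D) + Complex.exp P * (D - h * Q) := by
    rw [hKP]; ring
  rw [hid]
  calc _ ≤ ‖Complex.exp P‖ * ‖Complex.exp D - 1 - D‖ + ‖Complex.exp P‖ * ‖D - h * Q‖ := by
        rw [← norm_mul, ← norm_mul]; exact norm_add_le _ _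
    _ ≤ ‖Complex.exp P‖ * (3 * ‖D‖ ^ 2 * max 1 (Real.exp D.re)) +
        M * (h ^ 2 * (19 * E * X ^ 5)) := by
        gcongr
        exact norm_exp_sub_one_sub_id_le_mul_max D
    _ = 3 * ‖D‖ ^ 2 * (‖Complex.exp P‖ * max 1 (Real.exp D.re)) +
        M * (h ^ 2 * (19 * E * X ^ 5)) := by ring
    _ ≤ 3 * (h * (B * X ^ 5)) ^ 2 * M + M * (h ^ 2 * (B * X ^ 10)) := by
        have hB0 : 0 ≤ B := by linarith
        have hEB : 19 * E ≤ B := by linarith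
        gcongr
    _ = _ := by ring

theorem exists_norm_indicator_exp_oscPhase_sub_le : ∃ C > 0, ∀ k h s L u : ℝ, 0 ≤ k → k ≤ 1 →
    0 < h → h ≤ 1 / 2 → h * (1 + L) ≤ 1 → -L ≤ s →
    ‖(Set.Ioc (-(π / h)) (π / h)).indicator
        (fun u => Complex.exp (oscPhase k h s (vertLine u))) u -
      Complex.exp (airyPhase s (vertLine u)) -
      h * (phaseCorr k s (vertLine u) * Complex.exp (airyPhase s (vertLine u)))‖ ≤
    C * (h ^ 2 * ((1 + |u|) * (1 + |s|)) ^ 10 *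
      (Real.exp (1 - s) * Real.exp (-(1 / 10) * u ^ 2))) := by
  obtain ⟨B, hB⟩ : ∃ B, 2 + 19 * Real.exp 10 ≤ B := ⟨_, le_rfl⟩
  have hBpos : 0 < B := lt_of_lt_of_le (by positivity) hB
  obtain ⟨C, hC1, hC3⟩ : ∃ C, 3 * B ^ 2 + B ≤ C ∧ 3 ≤ C :=
    ⟨max _ _, le_max_left _ _, le_max_right _ _⟩
  refine ⟨C, by linarith, fun k h s L u hk0 hk1 h0 hh hhL hs => ?_⟩
  have hu0 := abs_nonneg u
  have hs0 := abs_nonneg s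
  have hus := mul_nonneg hu0 hs0
  have hX : 1 ≤ (1 + |u|) * (1 + |s|) := by nlinarith
  have hsX : |s| ≤ (1 + |u|) * (1 + |s|) := by nlinarith
  have huX : 1 + |u| ≤ (1 + |u|) * (1 + |s|) := by nlinarith
  generalize (1 + |u|) * (1 + |s|) = X at hX hsX huX ⊢
  by_cases hmem : u ∈ Set.Ioc (-(π / h)) (π / h)
  · rw [Set.indicator_of_mem hmem]
    have hhu : |h * u| ≤ π := by
      rw [abs_mul, abs_of_pos h0, ← le_div_iff₀' h0]
      exact abs_le.mpr ⟨hmem.1.le, hmem.2⟩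
    refine (norm_exp_oscPhase_sub_le hB hk0 hk1 h0 hh hhL hs hX hsX huX hhu).trans ?_
    exact mul_le_mul_of_nonneg_right hC1 (by positivity)
  · rw [Set.indicator_of_notMem hmem, zero_sub]
    have hnh : ‖(h : ℂ)‖ = h := by simp [abs_of_pos h0]
    have hX7 : X ^ 7 ≤ X ^ 10 := pow_le_pow_right₀ hX (by norm_num)
    have hQ := norm_phaseCorr_le hk0 hk1 hX hsX huX
    have hP := norm_exp_airyPhase_vertLine_le s u
    have hM : 0 < Real.exp (1 - s) * Real.exp (-(1 / 10) * u ^ 2) := by positivity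
    generalize Real.exp (1 - s) * Real.exp (-(1 / 10) * u ^ 2) = M at hP hM ⊢
    have hge : 1 ≤ h * |u| := by
      rw [Set.mem_Ioc, not_and_or, not_lt, not_le] at hmem
      have hle : π / h ≤ |u| := by
        rcases hmem with hm | hm
        · exact le_abs.mpr (Or.inr (by linarith))
        · exact le_abs.mpr (Or.inl hm.le)
      rw [div_le_iff₀' h0] at hle
      linarith [Real.pi_gt_three]
    have hge2 : 1 ≤ h ^ 2 * X ^ 2 := by
      calc (1 : ℝ) ≤ (h * |u|) ^ 2 := one_le_pow₀ hge
        _ ≤ (h * X) ^ 2 := by gcongr; linarith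
        _ = _ := by ring
    generalize phaseCorr k s (vertLine u) = Q at hQ ⊢
    generalize airyPhase s (vertLine u) = P at hP ⊢
    calc _ ≤ ‖-Complex.exp P‖ + ‖h * (Q * Complex.exp P)‖ := norm_sub_le _ _
      _ = (1 + h * ‖Q‖) * ‖Complex.exp P‖ := by rw [norm_neg, norm_mul, norm_mul, hnh]; ring
      _ ≤ (1 * X ^ 5 + 1 * (2 * X ^ 5)) * M := by
        gcongr
        · rw [one_mul]; exact one_le_pow₀ hX
        · linarith
      _ = 1 * (3 * X ^ 5) * M := by ring
      _ ≤ (h ^ 2 * X ^ 2) * (3 * X ^ 5) * M := by gcongr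
      _ = 3 * (h ^ 2 * X ^ 7 * M) := by ring
      _ ≤ _ := by gcongr

theorem integrable_gaussWeight :
    Integrable fun u : ℝ => (1 + |u|) ^ 10 * Real.exp (-(1 / 10) * u ^ 2) := by
  have h1 := integrable_rpow_mul_exp_neg_mul_sq (b := 1 / 10) (by norm_num) (s := (10 : ℕ))
    (by norm_num)
  simp only [Real.rpow_natCast] at h1
  have h0 := integrable_exp_neg_mul_sq (b := 1 / 10) (by norm_num)
  refine ((h0.add h1).const_mul (2 ^ 9)).mono' ?_ (Eventually.of_forall fun u => ?_)
  · exact Continuous.aestronglyMeasurable (by fun_prop)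
  · rw [Real.norm_of_nonneg (by positivity)]
    have := add_pow_le zero_le_one (abs_nonneg u) 10
    rw [show |u| ^ 10 = u ^ 10 from Even.pow_abs (by decide) u, one_pow] at this
    calc _ ≤ 2 ^ (10 - 1) * (1 + u ^ 10) * Real.exp (-(1 / 10) * u ^ 2) := by gcongr
      _ = _ := by simp only [Pi.add_apply]; ring

/-- The constant by which integrals along `Re w = -1` are bounded. -/
noncomputable def gaussMoment : ℝ := ∫ u : ℝ, (1 + |u|) ^ 10 * Real.exp (-(1 / 10) * u ^ 2)

theorem gaussMoment_nonneg : 0 ≤ gaussMoment :=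
  integral_nonneg fun u => by positivity

/-- Integrals along `Re w = -1` of functions bounded by a polynomial times a Gaussian. -/
theorem norm_integral_le_gaussMoment {f : ℝ → ℂ} {C : ℝ}
    (hf : ∀ u, ‖f u‖ ≤ C * ((1 + |u|) ^ 10 * Real.exp (-(1 / 10) * u ^ 2))) :
    ‖((2 * π)⁻¹ : ℂ) * ∫ u, f u‖ ≤ C * gaussMoment := by
  have h1 : ‖∫ u, f u‖ ≤ C * gaussMoment := by
    rw [gaussMoment, ← integral_const_mul]
    exact norm_integral_le_of_norm_le (integrable_gaussWeight.const_mul C)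
      (Eventually.of_forall hf)
  have h2 : ‖((2 * π)⁻¹ : ℂ)‖ ≤ 1 := by
    have : ‖((2 * π)⁻¹ : ℂ)‖ = (2 * π)⁻¹ := by
      simp [abs_of_pos Real.pi_pos]
    rw [this]
    exact inv_le_one_of_one_le₀ (by linarith [Real.pi_gt_three])
  rw [norm_mul]
  calc _ ≤ 1 * ‖∫ u, f u‖ := by gcongr
    _ ≤ _ := by rwa [one_mul]

theorem continuous_phaseCorr (k s : ℝ) : Continuous (phaseCorr k s) := by
  unfold phaseCorr
  fun_prop

theorem continuous_oscPhase (k h s : ℝ) : Continuous (oscPhase k h s) := by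
  unfold oscPhase
  fun_prop

theorem one_le_weight (u : ℝ) : 1 ≤ (1 + |u|) ^ 10 :=
  one_le_pow₀ (by linarith [abs_nonneg u])

theorem norm_phaseCorr_mul_exp_le {k s : ℝ} (hk0 : 0 ≤ k) (hk1 : k ≤ 1) (u : ℝ) :
    ‖phaseCorr k s (vertLine u) * Complex.exp (airyPhase s (vertLine u))‖ ≤
      2 * ((1 + |s|) ^ 10 * Real.exp (1 - s)) *
        ((1 + |u|) ^ 10 * Real.exp (-(1 / 10) * u ^ 2)) := by
  have hu0 := abs_nonneg u
  have hs0 := abs_nonneg s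
  have hus := mul_nonneg hu0 hs0
  have hX : 1 ≤ (1 + |u|) * (1 + |s|) := by nlinarith
  have hQ := norm_phaseCorr_le (s := s) (u := u) hk0 hk1 hX (by nlinarith) (by nlinarith)
  have hX5 := pow_le_pow_right₀ hX (show 5 ≤ 10 by norm_num)
  rw [norm_mul]
  calc _ ≤ (2 * ((1 + |u|) * (1 + |s|)) ^ 10) *
        (Real.exp (1 - s) * Real.exp (-(1 / 10) * u ^ 2)) := by
        gcongr
        · exact hQ.trans (by linarith)
        · exact norm_exp_airyPhase_vertLine_le s u
    _ = _ := by ring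

theorem integrable_phaseCorr_mul_exp {k s : ℝ} (hk0 : 0 ≤ k) (hk1 : k ≤ 1) :
    Integrable fun u : ℝ =>
      phaseCorr k s (vertLine u) * Complex.exp (airyPhase s (vertLine u)) := by
  refine (integrable_gaussWeight.const_mul _).mono' ?_
    (Eventually.of_forall (norm_phaseCorr_mul_exp_le hk0 hk1))
  exact (((continuous_phaseCorr k s).comp continuous_vertLine).mul
    ((continuous_airyPhase s).comp continuous_vertLine).cexp).aestronglyMeasurable

/-- The coefficient of `N^{-1/3}` in the expansion of `φ_{N-k}`. -/
noncomputable def airyCorr (k s : ℝ) : ℂ :=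
  (2 * π)⁻¹ * ∫ u : ℝ, phaseCorr k s (vertLine u) * Complex.exp (airyPhase s (vertLine u))

theorem norm_airyCorr_le {k : ℝ} (s : ℝ) (hk0 : 0 ≤ k) (hk1 : k ≤ 1) :
    ‖airyCorr k s‖ ≤ 2 * ((1 + |s|) ^ 10 * Real.exp (1 - s)) * gaussMoment := by
  unfold airyCorr
  simpa using norm_integral_le_gaussMoment (norm_phaseCorr_mul_exp_le (s := s) hk0 hk1)

/-- The first-order corrections of `φ_N` and `φ_{N-1}` cancel: their sum is the integral of an
exact derivative. -/
theorem airyCorr_zero_add_airyCorr_one (s : ℝ) : airyCorr 0 s + airyCorr 1 s = 0 := by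
  have hv : ∀ u : ℝ, HasDerivAt vertLine Complex.I u := by
    intro u
    unfold vertLine
    simpa using ((hasDerivAt_id u).ofReal_comp.mul_const Complex.I).const_add (-1 : ℂ)
  have hderiv : ∀ u : ℝ, HasDerivAt
      (fun u : ℝ => (s - vertLine u ^ 2) * Complex.exp (airyPhase s (vertLine u)))
      ((-2 * Complex.I) *
        (phaseCorr 0 s (vertLine u) * Complex.exp (airyPhase s (vertLine u)) +
        phaseCorr 1 s (vertLine u) * Complex.exp (airyPhase s (vertLine u)))) u := by
    intro u
    have h1 := (((hv u).pow 2).const_sub (s : ℂ))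
    have h2 : HasDerivAt (fun u : ℝ => airyPhase s (vertLine u))
        (-(3 * vertLine u ^ 2 * Complex.I) / 3 + s * Complex.I) u := by
      unfold airyPhase
      exact ((((hv u).pow 3).neg.div_const 3).add ((hv u).const_mul (s : ℂ))).congr_deriv
        (by push_cast; ring)
    refine (h1.mul h2.cexp).congr_deriv ?_
    unfold phaseCorr
    simp only [Pi.pow_apply]
    push_cast
    ring
  have hint := (integrable_phaseCorr_mul_exp (s := s) le_rfl zero_le_one).add
    (integrable_phaseCorr_mul_exp (s := s) zero_le_one le_rfl)
  have hF : Integrable fun u : ℝ =>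
      (s - vertLine u ^ 2) * Complex.exp (airyPhase s (vertLine u)) := by
    refine (integrable_gaussWeight.const_mul ((1 + |s|) * Real.exp (1 - s))).mono' ?_
      (Eventually.of_forall fun u => ?_)
    · have h1 := continuous_vertLine
      exact (Continuous.mul (by fun_prop)
        ((continuous_airyPhase s).comp continuous_vertLine).cexp).aestronglyMeasurable
    · rw [norm_mul]
      have hu0 := abs_nonneg u
      have h10 : (1 + |u|) ^ 2 ≤ (1 + |u|) ^ 10 :=
        pow_le_pow_right₀ (by linarith) (by norm_num)
      have h3 : ‖s - vertLine u ^ 2‖ ≤ (1 + |s|) * (1 + |u|) ^ 10 := by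
        calc _ ≤ ‖(s : ℂ)‖ + ‖vertLine u ^ 2‖ := norm_sub_le _ _
          _ = |s| + ‖vertLine u‖ ^ 2 := by simp
          _ ≤ |s| * (1 + |u|) ^ 10 + (1 + |u|) ^ 10 := by
            gcongr
            · exact le_mul_of_one_le_right (abs_nonneg s) (one_le_weight u)
            · exact (pow_le_pow_left₀ (norm_nonneg _) (norm_vertLine_le u) 2).trans h10
          _ = _ := by ring
      calc _ ≤ ((1 + |s|) * (1 + |u|) ^ 10) *
            (Real.exp (1 - s) * Real.exp (-(1 / 10) * u ^ 2)) := by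
            gcongr
            exact norm_exp_airyPhase_vertLine_le s u
        _ = _ := by ring
  have hzero := integral_eq_zero_of_hasDerivAt_of_integrable hderiv
    (hint.const_mul (-2 * Complex.I)) hF
  rw [integral_const_mul, integral_add (integrable_phaseCorr_mul_exp le_rfl zero_le_one)
    (integrable_phaseCorr_mul_exp zero_le_one le_rfl)] at hzero
  have hI : (-2 * Complex.I : ℂ) ≠ 0 := by simp
  have := (mul_eq_zero.mp hzero).resolve_left hI
  unfold airyCorr
  rw [← mul_add, this, mul_zero]

theorem oscIntegral_eq_integral_indicator {k h s : ℝ} (h0 : 0 < h) :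
    oscIntegral k h s = (2 * π)⁻¹ * ∫ u : ℝ, (Set.Ioc (-(π / h)) (π / h)).indicator
        (fun u => Complex.exp (oscPhase k h s (vertLine u))) u := by
  have : -(π / h) ≤ π / h := by linarith [div_pos Real.pi_pos h0]
  rw [oscIntegral, intervalIntegral.integral_of_le this, integral_indicator measurableSet_Ioc]

theorem integrable_indicator_exp_oscPhase (k h s : ℝ) :
    Integrable ((Set.Ioc (-(π / h)) (π / h)).indicator
        (fun u => Complex.exp (oscPhase k h s (vertLine u)))) := by
  have hc : Continuous fun u => Complex.exp (oscPhase k h s (vertLine u)) :=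
    ((continuous_oscPhase k h s).comp continuous_vertLine).cexp
  exact (hc.integrableOn_Icc.mono_set Set.Ioc_subset_Icc_self).integrable_indicator
    measurableSet_Ioc

theorem norm_oscIntegral_le {k h s L : ℝ} (hk : 0 ≤ k) (h0 : 0 < h) (h1 : h ≤ 1 / 2)
    (hhL : h * (1 + L) ≤ 1) (hs : -L ≤ s) :
    ‖oscIntegral k h s‖ ≤ Real.exp (1 - s) * gaussMoment := by
  rw [oscIntegral_eq_integral_indicator h0]
  push_cast
  refine norm_integral_le_gaussMoment fun u => ?_
  have hw := one_le_weight u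
  by_cases hmem : u ∈ Set.Ioc (-(π / h)) (π / h)
  · rw [Set.indicator_of_mem hmem]
    have hhu : |h * u| ≤ π := by
      rw [abs_mul, abs_of_pos h0, ← le_div_iff₀' h0]
      exact abs_le.mpr ⟨hmem.1.le, hmem.2⟩
    refine (norm_exp_oscPhase_le hk h0 h1 hhL hs hhu).trans ?_
    gcongr
    exact le_mul_of_one_le_left (Real.exp_pos _).le hw
  · rw [Set.indicator_of_notMem hmem, norm_zero]
    positivity

theorem norm_airyIntegral_sub_le {s δ : ℝ} (hδ : |δ| ≤ 1) :
    ‖airyIntegral (s + δ) - airyIntegral s‖ ≤ 2 * Real.exp 1 * |δ| * Real.exp (1 - s) * gaussMoment := by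
  unfold airyIntegral
  rw [← mul_sub, ← integral_sub (integrable_exp_airyPhase _) (integrable_exp_airyPhase _)]
  push_cast
  refine norm_integral_le_gaussMoment fun u => ?_
  have hu0 := abs_nonneg u
  have h10 : 1 + |u| ≤ (1 + |u|) ^ 10 := le_self_pow₀ (by linarith) (by norm_num)
  have hid : airyPhase (s + δ) (vertLine u) = airyPhase s (vertLine u) + δ * vertLine u := by
    unfold airyPhase; push_cast; ring
  have hre : ((δ : ℂ) * vertLine u).re ≤ 1 := by
    rw [Complex.re_ofReal_mul]
    have : (vertLine u).re = -1 := by simp [vertLine]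
    rw [this]
    linarith [neg_le_abs δ]
  rw [hid, Complex.exp_add, ← mul_sub_one, norm_mul]
  have hmax : max 1 (Real.exp ((δ : ℂ) * vertLine u).re) ≤ Real.exp 1 :=
    max_le (Real.one_le_exp zero_le_one) (Real.exp_le_exp.mpr hre)
  have hexp : ‖Complex.exp (δ * vertLine u) - 1‖ ≤ 2 * (|δ| * (1 + |u|) ^ 10) * Real.exp 1 := by
    refine (norm_exp_sub_one_le_mul_max _).trans ?_
    rw [norm_mul, Complex.norm_real, Real.norm_eq_abs]
    gcongr
    exact (norm_vertLine_le u).trans h10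
  calc _ ≤ (Real.exp (1 - s) * Real.exp (-(1 / 10) * u ^ 2)) *
        (2 * (|δ| * (1 + |u|) ^ 10) * Real.exp 1) := by
        gcongr
        exact norm_exp_airyPhase_vertLine_le s u
    _ = _ := by ring

/-- Two-term expansion of the contour integrals in powers of `h = N^{-1/3}`. -/
theorem exists_norm_oscIntegral_sub_le : ∃ C > 0, ∀ k h s L : ℝ, 0 ≤ k → k ≤ 1 →
    0 < h → h ≤ 1 / 2 → h * (1 + L) ≤ 1 → -L ≤ s →
    ‖oscIntegral k h s - airyIntegral s - h * airyCorr k s‖ ≤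
      C * h ^ 2 * ((1 + |s|) ^ 10 * Real.exp (1 - s)) := by
  obtain ⟨C, hC, hbound⟩ := exists_norm_indicator_exp_oscPhase_sub_le
  refine ⟨C * (gaussMoment + 1), by have := gaussMoment_nonneg; positivity,
    fun k h s L hk0 hk1 h0 hh hhL hs => ?_⟩
  have hid : oscIntegral k h s - airyIntegral s - h * airyCorr k s =
      ((2 * π)⁻¹ : ℂ) * ∫ u : ℝ, ((Set.Ioc (-(π / h)) (π / h)).indicator
        (fun u => Complex.exp (oscPhase k h s (vertLine u))) u -
      Complex.exp (airyPhase s (vertLine u)) -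
      h * (phaseCorr k s (vertLine u) * Complex.exp (airyPhase s (vertLine u)))) := by
    have i1 : Integrable fun u : ℝ => (Set.Ioc (-(π / h)) (π / h)).indicator
        (fun u => Complex.exp (oscPhase k h s (vertLine u))) u :=
      integrable_indicator_exp_oscPhase k h s
    have i2 := integrable_exp_airyPhase s
    have i12 : Integrable fun u : ℝ => (Set.Ioc (-(π / h)) (π / h)).indicator
        (fun u => Complex.exp (oscPhase k h s (vertLine u))) u -
        Complex.exp (airyPhase s (vertLine u)) := i1.sub i2
    have i3 := (integrable_phaseCorr_mul_exp (s := s) hk0 hk1).const_mul (h : ℂ)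
    rw [integral_sub i12 i3, integral_sub i1 i2, integral_const_mul,
      oscIntegral_eq_integral_indicator h0, airyIntegral, airyCorr]
    push_cast
    ring
  rw [hid]
  have := norm_integral_le_gaussMoment
    (C := C * h ^ 2 * ((1 + |s|) ^ 10 * Real.exp (1 - s))) (fun u =>
      (hbound k h s L u hk0 hk1 h0 hh hhL hs).trans (le_of_eq (by ring)))
  refine this.trans ?_
  calc _ ≤ C * h ^ 2 * ((1 + |s|) ^ 10 * Real.exp (1 - s)) * (gaussMoment + 1) := by
        gcongr; linarith
    _ = _ := by ring

theorem exists_weight_mul_exp_le (L : ℝ) : ∃ C > 0, ∀ s : ℝ, -L ≤ s →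
    (1 + |s|) ^ 10 * Real.exp (1 - s) ≤ C * Real.exp (-s / 2) := by
  refine ⟨2 ^ 10 * (Nat.factorial 10) * Real.exp (3 / 2 + |L|), by positivity, fun s hs => ?_⟩
  have h1 := Real.pow_div_factorial_le_exp ((1 + |s|) / 2) (by positivity) 10
  have h2 : |s| ≤ s + 2 * |L| := by
    have := le_abs_self L
    have := abs_nonneg L
    exact abs_le.mpr ⟨by linarith, by linarith⟩
  rw [div_le_iff₀ (by positivity)] at h1
  calc (1 + |s|) ^ 10 * Real.exp (1 - s) = 2 ^ 10 * ((1 + |s|) / 2) ^ 10 * Real.exp (1 - s) := by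
        ring
    _ ≤ 2 ^ 10 * (Real.exp ((1 + |s|) / 2) * Nat.factorial 10) * Real.exp (1 - s) := by gcongr
    _ = 2 ^ 10 * (Nat.factorial 10) * Real.exp ((1 + |s|) / 2 + (1 - s)) := by
        rw [Real.exp_add]; ring
    _ ≤ 2 ^ 10 * (Nat.factorial 10) * Real.exp ((3 / 2 + |L|) + -s / 2) := by
        gcongr 2 ^ 10 * (Nat.factorial 10) * Real.exp ?_
        linarith
    _ = _ := by rw [Real.exp_add]; ring

/-- The normalization constant relating the rescaled wave functions to `oscIntegral`. -/
noncomputable def normConst (N : ℕ) : ℝ := √(Stirling.stirlingSeq N / √π)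

theorem stirlingSeq_pos {n : ℕ} (hn : n ≠ 0) : 0 < Stirling.stirlingSeq n :=
  (by positivity : 0 < √π).trans_le (Stirling.sqrt_pi_le_stirlingSeq hn)

theorem log_stirlingSeq_le {n : ℕ} (hn : n ≠ 0) :
    Real.log (Stirling.stirlingSeq n) ≤ Real.log √π + 1 / (12 * n) := by
  have hmono : Monotone fun m : ℕ =>
      Real.log (Stirling.stirlingSeq (m + 1)) - 1 / (12 * ((m : ℝ) + 1)) := by
    refine monotone_nat_of_le_succ fun m => ?_
    have := Stirling.log_stirlingSeq_sdiff_le (m + 1)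
    have h : (1 : ℝ) / (12 * ((m : ℝ) + 1)) - 1 / (12 * ((m : ℝ) + 1 + 1)) =
        1 / (12 * ((m : ℝ) + 1) * ((m : ℝ) + 1 + 1)) := by
      field_simp
      ring
    push_cast at this ⊢
    linarith
  have hlim : Tendsto (fun m : ℕ =>
      Real.log (Stirling.stirlingSeq (m + 1)) - 1 / (12 * ((m : ℝ) + 1))) atTop
      (𝓝 (Real.log √π - 12⁻¹ * 0)) := by
    refine Tendsto.sub ?_ ?_
    · exact ((Real.continuousAt_log (by positivity)).tendsto.comp
        Stirling.tendsto_stirlingSeq_sqrt_pi).comp (tendsto_add_atTop_nat 1)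
    · refine (tendsto_one_div_add_atTop_nhds_zero_nat.const_mul (12⁻¹ : ℝ)).congr fun m => ?_
      field_simp
  obtain ⟨m, rfl⟩ := Nat.exists_eq_succ_of_ne_zero hn
  have := hmono.ge_of_tendsto hlim m
  push_cast
  simp only [Nat.succ_eq_add_one]
  linarith

theorem one_le_normConst {N : ℕ} (hN : N ≠ 0) : 1 ≤ normConst N := by
  rw [normConst, Real.one_le_sqrt, one_le_div (by positivity)]
  exact Stirling.sqrt_pi_le_stirlingSeq hN

theorem normConst_le {N : ℕ} (hN : N ≠ 0) : normConst N ≤ 1 + 1 / N := by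
  have hpos := stirlingSeq_pos hN
  have hN1 : (1 : ℝ) ≤ N := by exact_mod_cast Nat.one_le_iff_ne_zero.mpr hN
  have h1 : 1 ≤ Stirling.stirlingSeq N / √π := by
    rw [one_le_div (by positivity)]
    exact Stirling.sqrt_pi_le_stirlingSeq hN
  calc normConst N ≤ Stirling.stirlingSeq N / √π :=
        Real.sqrt_le_iff.mpr ⟨by positivity, by nlinarith⟩
    _ = Real.exp (Real.log (Stirling.stirlingSeq N) - Real.log √π) := by
        rw [Real.exp_sub, Real.exp_log hpos, Real.exp_log (by positivity)]
    _ ≤ Real.exp (1 / (12 * N)) := by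
        gcongr
        linarith [log_stirlingSeq_le hN]
    _ ≤ 1 / (1 - 1 / (12 * N)) := by
        have : (1 : ℝ) / (12 * N) < 1 := by rw [div_lt_one] <;> linarith
        rw [le_one_div (Real.exp_pos _) (by linarith), one_div (Real.exp _), ← Real.exp_neg]
        linarith [Real.add_one_le_exp (-(1 / (12 * N) : ℝ))]
    _ ≤ 1 + 1 / N := by
        have : (0 : ℝ) < 12 * N - 1 := by linarith
        rw [show (1 : ℝ) - 1 / (12 * N) = (12 * N - 1) / (12 * N) by field_simp,
          one_div_div, div_le_iff₀ this]
        field_simp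
        nlinarith

/-- Up to `normConst`, the rescaled wave functions are contour integrals. -/
theorem rescaled_osc_eq {N n k : ℕ} {h c τ : ℝ} (hN : N ≠ 0) (hnk : n + k = N) (hk : k ≤ 1)
    (hh : 0 < h) (hc : 0 < c) (hτ : 0 < τ) (hc2 : c ^ 2 = 2 / h ^ 3) (hcτ : c * τ = 1 / h)
    (hτ2 : τ ^ 2 = h / 2) (hNh : (N : ℝ) = 1 / h ^ 3) (s : ℝ) :
    (((2 * N : ℝ) ^ ((1 : ℝ) / 4) * τ * osc n (c + τ * s) : ℝ) : ℂ) =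
      normConst N * oscIntegral k h s := by
  have hN0 : (0 : ℝ) < N := by positivity
  have hconst : (2 * N : ℝ) ^ ((1 : ℝ) / 4) * τ *
      (hNorm n ^ (-(1 : ℝ) / 2) * n.factorial * ((c / 2) ^ n)⁻¹ * Real.exp (1 / h ^ 3 / 2) * h) =
      normConst N := by
    have hnorm : 0 < hNorm n := by unfold hNorm; positivity
    refine (Real.sqrt_eq_iff_mul_self_eq (by have := stirlingSeq_pos hN; positivity)
      (by positivity)).mpr (Eq.symm ?_) |>.symm
    have e1 : ((2 * N : ℝ) ^ ((1 : ℝ) / 4)) ^ 2 = √(2 * N) := by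
      rw [← Real.rpow_natCast, ← Real.rpow_mul (by positivity), Real.sqrt_eq_rpow]
      norm_num
    have e2 : (hNorm n ^ (-(1 : ℝ) / 2)) ^ 2 = (hNorm n)⁻¹ := by
      rw [← Real.rpow_natCast, ← Real.rpow_mul (by positivity), ← Real.rpow_neg_one]
      norm_num
    have e3 : Real.exp (1 / h ^ 3 / 2) ^ 2 = Real.exp 1 ^ N := by
      rw [← Real.exp_nat_mul, ← Real.exp_nat_mul, ← hNh]
      congr 1
      push_cast
      ring
    have e4 : (((c / 2) ^ n)⁻¹) ^ 2 = (2 / N : ℝ) ^ n := by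
      have : (c / 2) ^ 2 = N / 2 := by rw [div_pow, hc2, hNh]; ring
      rw [inv_pow, ← pow_mul, mul_comm, pow_mul, this, ← inv_pow, inv_div]
    have e5 : h ^ 3 = 1 / N := by rw [hNh, one_div_one_div]
    have e6 : (n.factorial : ℝ) / N ^ n = N.factorial / N ^ N := by
      interval_cases k
      · rw [add_zero] at hnk
        rw [hnk]
      · subst hnk
        rw [Nat.factorial_succ, pow_succ]
        push_cast at hN0 ⊢
        field_simp
    have e7 : √(2 * N : ℝ) / (2 * N) = 1 / √(2 * N) := by
      rw [Real.sqrt_div_self']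
    calc _ = ((2 * N : ℝ) ^ ((1 : ℝ) / 4)) ^ 2 * τ ^ 2 * ((hNorm n ^ (-(1 : ℝ) / 2)) ^ 2 *
          n.factorial ^ 2 * (((c / 2) ^ n)⁻¹) ^ 2 * Real.exp (1 / h ^ 3 / 2) ^ 2 * h ^ 2) := by ring
      _ = √(2 * N) * (h ^ 3 / 2) * ((hNorm n)⁻¹ * n.factorial ^ 2 * (2 / N) ^ n *
          Real.exp 1 ^ N) := by
          rw [e1, e2, e3, e4, hτ2]; ring
      _ = √(2 * N) / (2 * N) * ((n.factorial : ℝ) / N ^ n) * Real.exp 1 ^ N / √π := by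
          rw [e5, hNorm, div_pow]; field_simp
      _ = Stirling.stirlingSeq N / √π := by
          rw [e6, e7, Stirling.stirlingSeq, div_pow]
          field_simp
  rw [← hconst, Complex.ofReal_mul, osc_eq_oscIntegral hh hc hc2 hcτ hτ2
    (by rw [← hNh, ← hnk]; push_cast; rfl)]
  push_cast
  ring

/-- Uniform bounds for a contour integral whose argument is shifted by `δ = O(h ^ 2)` and whose
normalization is `1 + O(h ^ 2)`. -/
theorem exists_norm_mul_oscIntegral_le (L : ℝ) : ∃ D > 0, ∀ k h s δ A : ℝ, 0 ≤ k → k ≤ 1 →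
    0 < h → h ≤ 1 / 2 → h * (1 + L) ≤ 1 → |δ| ≤ h ^ 2 → -L ≤ s + δ → 1 ≤ A → A ≤ 1 + h ^ 2 →
    ‖A * oscIntegral k h (s + δ)‖ ≤ D * Real.exp (-s) ∧
    ‖A * oscIntegral k h (s + δ) - airyIntegral s - h * airyCorr k (s + δ)‖ ≤
      D * h ^ 2 * Real.exp (-s / 2) ∧
    ‖airyCorr k (s + δ)‖ ≤ D * Real.exp (-s / 2) := by
  obtain ⟨C, hC, hexp⟩ := exists_norm_oscIntegral_sub_le
  obtain ⟨W, hW, hweight⟩ := exists_weight_mul_exp_le (L + 1)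
  have hM := gaussMoment_nonneg
  set M := gaussMoment
  set P := W * Real.exp 1 with hP
  have hP0 : 0 < P := by positivity
  obtain ⟨D, hD, hD1, hD2, hD3⟩ : ∃ D > 0, 2 * Real.exp 2 * M ≤ D ∧
      P * M + C * P + 2 * Real.exp 1 * P * M ≤ D ∧ 2 * P * M ≤ D := by
    have q1 : 0 ≤ 2 * Real.exp 2 * M := by positivity
    have q2 : 0 < P * M + C * P + 2 * Real.exp 1 * P * M := by positivity
    have q3 : 0 ≤ 2 * P * M := by positivity
    exact ⟨2 * Real.exp 2 * M + (P * M + C * P + 2 * Real.exp 1 * P * M) + 2 * P * M,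
      by linarith, by linarith, by linarith, by linarith⟩
  refine ⟨D, hD, fun k h s δ A hk0 hk1 h0 hh hhL hδ hs hA1 hA2 => ?_⟩
  have hδ1 : |δ| ≤ 1 := hδ.trans (by nlinarith)
  obtain ⟨hδl, hδu⟩ := abs_le.mp hδ1
  have one_le_pow (x : ℝ) : 1 ≤ (1 + |x|) ^ 10 := one_le_pow₀ (by linarith [abs_nonneg x])
  have w1 : (1 + |s + δ|) ^ 10 * Real.exp (1 - (s + δ)) ≤ P * Real.exp (-s / 2) := by
    refine (hweight (s + δ) (by linarith)).trans ?_
    rw [hP, mul_assoc, ← Real.exp_add]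
    gcongr
    linarith
  have w2 : Real.exp (1 - s) ≤ P * Real.exp (-s / 2) := by
    calc Real.exp (1 - s) ≤ (1 + |s|) ^ 10 * Real.exp (1 - s) :=
          le_mul_of_one_le_left (Real.exp_pos _).le (one_le_pow s)
      _ ≤ W * Real.exp (-s / 2) := hweight s (by linarith)
      _ ≤ P * Real.exp (-s / 2) := by
          gcongr
          exact le_mul_of_one_le_right hW.le (by simp)
  have w3 : Real.exp (1 - (s + δ)) ≤ P * Real.exp (-s / 2) :=
    (le_mul_of_one_le_left (Real.exp_pos _).le (one_le_pow (s + δ))).trans w1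
  set E := Real.exp (-s / 2)
  have hE : 0 < E := Real.exp_pos _
  have hO := norm_oscIntegral_le hk0 h0 hh hhL hs
  have hA : ‖(A : ℂ)‖ ≤ 2 := by
    rw [Complex.norm_real, Real.norm_of_nonneg (by linarith)]
    nlinarith
  refine ⟨?_, ?_, ?_⟩
  · calc _ ≤ 2 * (Real.exp (2 - s) * M) := by
          rw [norm_mul]
          gcongr
          exact hO.trans (mul_le_mul_of_nonneg_right (Real.exp_le_exp.mpr (by linarith)) hM)
      _ = 2 * Real.exp 2 * M * Real.exp (-s) := by
          rw [sub_eq_add_neg, Real.exp_add]; ring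
      _ ≤ _ := by
          gcongr
  · have t1 : ‖((A - 1 : ℝ) : ℂ) * oscIntegral k h (s + δ)‖ ≤ h ^ 2 * (P * E * M) := by
      rw [norm_mul, Complex.norm_real, Real.norm_of_nonneg (by linarith)]
      gcongr
      · linarith
      · refine hO.trans ?_
        gcongr
    have t2 := hexp k h (s + δ) L hk0 hk1 h0 hh hhL hs
    have t3 : ‖airyIntegral (s + δ) - airyIntegral s‖ ≤ 2 * Real.exp 1 * h ^ 2 * (P * E) * M := by
      refine (norm_airyIntegral_sub_le hδ1).trans ?_
      gcongr
    have hsplit : A * oscIntegral k h (s + δ) - airyIntegral s - h * airyCorr k (s + δ) =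
        ((A - 1 : ℝ) : ℂ) * oscIntegral k h (s + δ) +
        (oscIntegral k h (s + δ) - airyIntegral (s + δ) - h * airyCorr k (s + δ)) +
        (airyIntegral (s + δ) - airyIntegral s) := by
      push_cast
      ring
    rw [hsplit]
    refine norm_add₃_le.trans ?_
    calc _ ≤ h ^ 2 * (P * E * M) + C * h ^ 2 * (P * E) +
          2 * Real.exp 1 * h ^ 2 * (P * E) * M := by
          gcongr
          refine t2.trans ?_
          gcongr
      _ = (P * M + C * P + 2 * Real.exp 1 * P * M) * h ^ 2 * E := by ring
      _ ≤ _ := by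
          gcongr
  · calc _ ≤ 2 * (P * E) * M := by
          refine (norm_airyCorr_le (s + δ) hk0 hk1).trans ?_
          gcongr
      _ = 2 * P * M * E := by ring
      _ ≤ _ := by
          gcongr

theorem abs_sqrt_add_sqrt_div_two_sub_sqrt_le {x : ℝ} (hx : 1 ≤ x) :
    |(√(x + 1) + √(x - 1)) / 2 - √x| ≤ 1 / (x * √x) := by
  have hc : 1 ≤ √x := Real.one_le_sqrt.mpr hx
  have ha := Real.sq_sqrt (show 0 ≤ x + 1 by linarith)
  have hb := Real.sq_sqrt (show 0 ≤ x - 1 by linarith)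
  have hc2 := Real.sq_sqrt (show 0 ≤ x by linarith)
  have ha0 := Real.sqrt_nonneg (x + 1)
  have hb0 := Real.sqrt_nonneg (x - 1)
  set a := √(x + 1)
  set b := √(x - 1)
  set c := √x
  have hab2 : (a * b) ^ 2 = x ^ 2 - 1 := by rw [mul_pow, ha, hb]; ring
  have hab_le : a * b ≤ x := abs_le_of_sq_le_sq' (by linarith) (by linarith) |>.2
  have hab_ge : x - 1 / x ≤ a * b := by
    refine abs_le_of_sq_le_sq' ?_ (by positivity) |>.2
    have h1 : (x - 1 / x) ^ 2 = x ^ 2 - 2 + (1 / x) ^ 2 := by field_simp; ring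
    have h2 : (1 / x) ^ 2 ≤ 1 := pow_le_one₀ (by positivity) (by rw [div_le_one] <;> linarith)
    linarith
  have hle : (a + b) / 2 ≤ c := by nlinarith
  have hge : c - (a + b) / 2 ≤ 1 / (x * c) := by
    have h1 : (c - (a + b) / 2) * c ≤ 1 / x := by
      have h2 : (c - (a + b) / 2) * (c + (a + b) / 2) ≤ 1 / x := by
        have : 0 < 1 / x := by positivity
        nlinarith
      nlinarith
    rw [← div_div]
    rwa [le_div_iff₀ (by linarith)]
  rw [abs_le]
  have : 0 < 1 / (x * c) := by positivity
  constructor <;> linarith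

theorem abs_muU_sub_sqrt_le {N : ℕ} (hN : N ≠ 0) :
    |muU N - √(2 * N)| ≤ 1 / (2 * N * √(2 * N)) := by
  have : (1 : ℝ) ≤ N := by exact_mod_cast Nat.one_le_iff_ne_zero.mpr hN
  exact abs_sqrt_add_sqrt_div_two_sub_sqrt_le (by linarith)

/-- Size of the shift between the centering `μ_N` and the turning point `√(2N)`. -/
theorem abs_muU_sub_sqrt_div_tauN_le {N : ℕ} {h : ℝ} (hN : N ≠ 0) (h0 : 0 < h) (h1 : h ≤ 1)
    (hcτ : √(2 * N) * tauN N = 1 / h) (hNh : (N : ℝ) = 1 / h ^ 3) (hτ : 0 < tauN N) :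
    |(muU N - √(2 * N)) / tauN N| ≤ h ^ 2 := by
  have hN0 : (0 : ℝ) < N := by positivity
  have hc : 0 < √(2 * N : ℝ) := by positivity
  rw [abs_div, abs_of_pos hτ, div_le_iff₀ hτ]
  refine (abs_muU_sub_sqrt_le hN).trans ?_
  rw [div_le_iff₀ (by positivity)]
  calc (1 : ℝ) ≤ 2 * (h ^ 3 * N) / h ^ 2 := by
        rw [hNh, mul_one_div_cancel (by positivity), le_div_iff₀ (by positivity)]
        nlinarith
    _ = h ^ 2 * (2 * N * (1 / h)) := by field_simp
    _ = h ^ 2 * tauN N * (2 * N * √(2 * N)) := by rw [← hcτ]; ring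
    _ ≤ _ := le_rfl

theorem tauN_sq (N : ℕ) : tauN N ^ 2 = (N : ℝ) ^ (-(1 : ℝ) / 3) / 2 := by
  rw [tauN, mul_pow, ← Real.rpow_natCast, ← Real.rpow_mul (by positivity), ← Real.rpow_natCast,
    ← Real.rpow_mul (by positivity)]
  norm_num [Real.rpow_neg_one]
  ring

theorem natCast_eq_one_div_rpow_cube (N : ℕ) :
    (N : ℝ) = 1 / ((N : ℝ) ^ (-(1 : ℝ) / 3)) ^ 3 := by
  rw [← Real.rpow_natCast, ← Real.rpow_mul (by positivity)]
  norm_num [Real.rpow_neg_one]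

theorem sqrt_two_mul_mul_tauN {N : ℕ} (hN : N ≠ 0) :
    √(2 * N) * tauN N = 1 / (N : ℝ) ^ (-(1 : ℝ) / 3) := by
  have hN0 : (0 : ℝ) < N := by positivity
  have hτ : 0 < tauN N := by unfold tauN; positivity
  have hh : 0 < (N : ℝ) ^ (-(1 : ℝ) / 3) := by positivity
  refine (pow_left_inj₀ (by positivity) (by positivity) two_ne_zero).mp ?_
  rw [mul_pow, tauN_sq, Real.sq_sqrt (by positivity)]
  have := natCast_eq_one_div_rpow_cube N
  generalize (N : ℝ) ^ (-(1 : ℝ) / 3) = h at *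
  rw [this]
  field_simp

/-- The rescaled wave functions as contour integrals at a slightly shifted argument. -/
theorem exists_phiTau_eq_psiTau_eq {N : ℕ} (hN : N ≠ 0) :
    ∃ δ : ℝ, |δ| ≤ ((N : ℝ) ^ (-(1 : ℝ) / 3)) ^ 2 ∧ ∀ s : ℝ,
      (phiTau N s : ℂ) =
        normConst N * oscIntegral 0 ((N : ℝ) ^ (-(1 : ℝ) / 3)) (s + δ) ∧
      (psiTau N s : ℂ) =
        normConst N * oscIntegral 1 ((N : ℝ) ^ (-(1 : ℝ) / 3)) (s + δ) := by
  have hN1 : (1 : ℝ) ≤ N := by exact_mod_cast Nat.one_le_iff_ne_zero.mpr hN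
  have hτ : 0 < tauN N := by unfold tauN; positivity
  have hc : 0 < √(2 * N : ℝ) := by positivity
  have hh : 0 < (N : ℝ) ^ (-(1 : ℝ) / 3) := by positivity
  have hh1 : (N : ℝ) ^ (-(1 : ℝ) / 3) ≤ 1 :=
    Real.rpow_le_one_of_one_le_of_nonpos hN1 (by norm_num)
  have hcτ := sqrt_two_mul_mul_tauN hN
  have hNh := natCast_eq_one_div_rpow_cube N
  have hτ2 := tauN_sq N
  have hc2 : √(2 * N : ℝ) ^ 2 = 2 / ((N : ℝ) ^ (-(1 : ℝ) / 3)) ^ 3 := by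
    rw [Real.sq_sqrt (by positivity), ← mul_one_div 2, ← hNh]
  refine ⟨_, abs_muU_sub_sqrt_div_tauN_le hN hh hh1 hcτ hNh hτ, fun s => ?_⟩
  have harg : muU N + tauN N * s =
      √(2 * N) + tauN N * (s + (muU N - √(2 * N)) / tauN N) := by
    field_simp
    ring
  constructor
  · rw [phiTau, harg, rescaled_osc_eq (k := 0) hN rfl (by norm_num) hh hc hτ hc2 hcτ hτ2 hNh,
      Nat.cast_zero]
  · rw [psiTau, harg, rescaled_osc_eq (k := 1) hN (Nat.sub_add_cancel (Nat.pos_of_ne_zero hN))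
      le_rfl hh hc hτ hc2 hcτ hτ2 hNh, Nat.cast_one]

/-- Key bounds in the unitary (GUE) case: exponential bounds, `N^{-1/3}` Airy approximation
for each function, and `N^{-2/3}` approximation for the average. -/
theorem unitary_key_bounds (sL : ℝ) :
    ∃ C > 0, ∃ N₀ : ℕ, ∀ N : ℕ, N₀ ≤ N → ∀ s : ℝ, sL ≤ s →
      |phiTau N s| ≤ C * Real.exp (-s) ∧
      |psiTau N s| ≤ C * Real.exp (-s) ∧
      |phiTau N s - Ai s| ≤ C * (N : ℝ) ^ (-(1 : ℝ) / 3) * Real.exp (-s / 2) ∧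
      |psiTau N s - Ai s| ≤ C * (N : ℝ) ^ (-(1 : ℝ) / 3) * Real.exp (-s / 2) ∧
      |phiTau N s + psiTau N s - 2 * Ai s| ≤
        C * (N : ℝ) ^ (-(2 : ℝ) / 3) * Real.exp (-s / 2) := by
  obtain ⟨D, hD, hbound⟩ := exists_norm_mul_oscIntegral_le (|sL| + 1)
  have hlim : Tendsto (fun N : ℕ => (N : ℝ) ^ (-(1 : ℝ) / 3)) atTop (𝓝 0) := by
    simpa only [neg_div, Function.comp_def] using
      (tendsto_rpow_neg_atTop (by norm_num : (0 : ℝ) < 1 / 3)).comp tendsto_natCast_atTop_atTop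
  obtain ⟨N₁, hN₁⟩ := eventually_atTop.mp
    ((hlim.eventually_le_const (by norm_num : (0 : ℝ) < 1 / 2)).and
      (hlim.eventually_le_const (by positivity : (0 : ℝ) < 1 / (1 + (|sL| + 1)))))
  refine ⟨2 * D, by positivity, N₁ + 1, fun N hN s hs => ?_⟩
  have hN0 : N ≠ 0 := by omega
  obtain ⟨hh, hhL⟩ := hN₁ N (by omega)
  rw [le_div_iff₀ (by positivity)] at hhL
  obtain ⟨δ, hδ, hrep⟩ := exists_phiTau_eq_psiTau_eq hN0
  obtain ⟨hφ, hψ⟩ := hrep s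
  have h0 : 0 < (N : ℝ) ^ (-(1 : ℝ) / 3) := by positivity
  have hNh := natCast_eq_one_div_rpow_cube N
  have hpow : (N : ℝ) ^ (-(2 : ℝ) / 3) = ((N : ℝ) ^ (-(1 : ℝ) / 3)) ^ 2 := by
    rw [← Real.rpow_natCast, ← Real.rpow_mul (by positivity)]
    norm_num
  rw [hpow]
  have hA1 := one_le_normConst hN0
  have hA2 : normConst N ≤ 1 + ((N : ℝ) ^ (-(1 : ℝ) / 3)) ^ 2 := by
    refine (normConst_le hN0).trans ?_
    rw [hNh, one_div_one_div, ← hNh]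
    gcongr 1 + ?_
    exact pow_le_pow_of_le_one h0.le (by linarith) (by norm_num)
  have hsδ : -(|sL| + 1) ≤ s + δ := by
    have := neg_abs_le sL
    have := neg_abs_le δ
    nlinarith
  have b (k : ℝ) (hk0 : 0 ≤ k) (hk1 : k ≤ 1) :=
    hbound k _ s δ (normConst N) hk0 hk1 h0 hh hhL hδ hsδ hA1 hA2
  obtain ⟨p1, p2, p3⟩ := b 0 le_rfl zero_le_one
  obtain ⟨q1, q2, q3⟩ := b 1 zero_le_one le_rfl
  rw [← hφ] at p1 p2
  rw [← hψ] at q1 q2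
  rw [← ofReal_Ai] at p2 q2
  have hcorr := airyCorr_zero_add_airyCorr_one (s + δ)
  generalize (N : ℝ) ^ (-(1 : ℝ) / 3) = h at *
  have hE := Real.exp_pos (-s / 2)
  have hE' := Real.exp_pos (-s)
  have hfirst {f K : ℂ} (hf : ‖f - Ai s - h * K‖ ≤ D * h ^ 2 * Real.exp (-s / 2))
      (hK : ‖K‖ ≤ D * Real.exp (-s / 2)) :
      ‖f - Ai s‖ ≤ 2 * D * h * Real.exp (-s / 2) := by
    calc ‖f - Ai s‖ = ‖(f - Ai s - h * K) + h * K‖ := by rw [sub_add_cancel]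
      _ ≤ D * h ^ 2 * Real.exp (-s / 2) + h * (D * Real.exp (-s / 2)) := by
          refine (norm_add_le _ _).trans (add_le_add hf ?_)
          rw [norm_mul, Complex.norm_real, Real.norm_of_nonneg h0.le]
          gcongr
      _ = D * (h * h) * Real.exp (-s / 2) + D * h * Real.exp (-s / 2) := by ring
      _ ≤ D * (h * 1) * Real.exp (-s / 2) + D * h * Real.exp (-s / 2) := by
          gcongr
          linarith
      _ = _ := by ring
  have hsum : ‖(phiTau N s : ℂ) + psiTau N s - 2 * Ai s‖ ≤
      2 * D * h ^ 2 * Real.exp (-s / 2) := by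
    calc _ = ‖(phiTau N s - Ai s - h * airyCorr 0 (s + δ)) +
          (psiTau N s - Ai s - h * airyCorr 1 (s + δ))‖ := by
          congr 1
          linear_combination (h : ℂ) * hcorr
      _ ≤ _ := (norm_add_le _ _).trans (add_le_add p2 q2)
      _ = _ := by ring
  have p4 := hfirst p2 p3
  have q4 := hfirst q2 q3
  norm_cast at p1 q1 p4 q4 hsum
  rw [Real.norm_eq_abs] at p1 q1 p4 q4 hsum
  exact ⟨by nlinarith, by nlinarith, p4, q4, hsum⟩
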